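/- arXiv:2207.14457 — 2 statements merged into one kernel-verified Lean document; each statement's English description precedes it below -/
import Mathlib

section
/- Let M ≥ 3 be a natural number, let D be a finite set of positive real numbers, and for each i ∈ {1,…,M} and d ∈ D let A_i(d) be a natural number such that Σ_{d∈D} A_i(d) = M − 1 for every i. Let E > 0 and σ > 0. Let f : ℝ → ℝ be continuous with f(x) = 0 for x < 0, f(x) > 0 for x > 0, and ∫_ℝ f(x) dx = 1. Define G(γ) = ∫_{−∞}^{γ} f(x) dx + (1/M) Σ_{i=1}^{M} Σ_{d∈D} A_i(d) ∫_{γ}^{∞} Q(d·√(E·x/(2σ²))) f(x) dx for γ ∈ [0, ∞). Then G has a unique minimiser on [0, ∞): there exists a unique γ* ∈ [0, ∞) such that G(γ*) < G(γ) for every γ ∈ [0, ∞) with γ ≠ γ*. -/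
open MeasureTheory Real

/-- The Gaussian Q-function: `Q x = (1/√(2π)) ∫_{x}^{∞} e^{−t²/2} dt`. -/
noncomputable def gaussianQ (x : ℝ) : ℝ :=
  (1 / Real.sqrt (2 * Real.pi)) * ∫ t in Set.Ioi x, Real.exp (-t ^ 2 / 2)

lemma integrable_exp_neg_sq_div_two : Integrable fun t : ℝ => Real.exp (-t ^ 2 / 2) := by
  convert integrable_exp_neg_mul_sq (b := 1 / 2) (by norm_num) using 3
  ring

lemma gaussianQ_sub_gaussianQ (a b : ℝ) :
    gaussianQ a - gaussianQ b =
      (1 / Real.sqrt (2 * Real.pi)) * ∫ t in a..b, Real.exp (-t ^ 2 / 2) := by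
  rw [gaussianQ, gaussianQ, ← mul_sub, intervalIntegral.integral_Ioi_sub_Ioi'
    integrable_exp_neg_sq_div_two.integrableOn integrable_exp_neg_sq_div_two.integrableOn]

lemma gaussianQ_strictAnti : StrictAnti gaussianQ := by
  intro a b hab
  rw [← sub_pos, gaussianQ_sub_gaussianQ]
  have : 0 < ∫ t in a..b, Real.exp (-t ^ 2 / 2) :=
    intervalIntegral.intervalIntegral_pos_of_pos_on
      integrable_exp_neg_sq_div_two.intervalIntegrable (fun x _ => Real.exp_pos _) hab
  positivity

lemma gaussianQ_zero : gaussianQ 0 = 1 / 2 := by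
  have h : ∫ t in Set.Ioi (0 : ℝ), Real.exp (-t ^ 2 / 2) = √(2 * π) / 2 := by
    have := integral_gaussian_Ioi (1 / 2)
    rw [show π / (1 / 2) = 2 * π by ring] at this
    rw [← this]
    congr with t
    ring_nf
  rw [gaussianQ, h]
  have : 0 < √(2 * π) := by positivity
  field_simp

lemma gaussianQ_nonneg (x : ℝ) : 0 ≤ gaussianQ x :=
  mul_nonneg (by positivity) (integral_nonneg fun _ => (Real.exp_pos _).le)

lemma gaussianQ_eq_sub_integral (x : ℝ) :
    gaussianQ x =
      gaussianQ 0 - (1 / Real.sqrt (2 * Real.pi)) * ∫ t in (0 : ℝ)..x, Real.exp (-t ^ 2 / 2) := by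
  rw [← gaussianQ_sub_gaussianQ]
  ring

lemma continuous_gaussianQ : Continuous gaussianQ := by
  rw [funext gaussianQ_eq_sub_integral]
  exact continuous_const.sub (continuous_const.mul
    (intervalIntegral.continuous_primitive
      (fun _ _ => integrable_exp_neg_sq_div_two.intervalIntegrable) 0))

lemma tendsto_gaussianQ_atTop : Filter.Tendsto gaussianQ Filter.atTop (nhds 0) := by
  rw [funext gaussianQ_eq_sub_integral]
  have h := ((intervalIntegral_tendsto_integral_Ioi 0
    integrable_exp_neg_sq_div_two.integrableOn Filter.tendsto_id).const_mul
      (1 / √(2 * π))).const_sub (gaussianQ 0)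
  rwa [show gaussianQ 0 - (1 / √(2 * π)) * ∫ t in Set.Ioi (0 : ℝ), Real.exp (-t ^ 2 / 2) = 0
    from sub_self _] at h

/-- The union bound on the error probability at channel gain `x`, averaged over the signals. -/
noncomputable def averagedUnionBound {M : ℕ} (D : Finset ℝ) (A : Fin M → ℝ → ℕ) (E σ x : ℝ) : ℝ :=
  (1 / (M : ℝ)) * ∑ i : Fin M, ∑ d ∈ D,
    (A i d : ℝ) * gaussianQ (d * Real.sqrt (E * x / (2 * σ ^ 2)))

section averagedUnionBound

variable {M : ℕ} {D : Finset ℝ} {A : Fin M → ℝ → ℕ} {E σ : ℝ}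

lemma continuous_averagedUnionBound : Continuous (averagedUnionBound D A E σ) := by
  have := continuous_gaussianQ
  unfold averagedUnionBound
  fun_prop

lemma averagedUnionBound_zero (hM : 1 ≤ M) (hA : ∀ i, ∑ d ∈ D, A i d = M - 1) :
    averagedUnionBound D A E σ 0 = ((M : ℝ) - 1) / 2 := by
  have hA' (i : Fin M) : ∑ d ∈ D, (A i d : ℝ) = (M : ℝ) - 1 := by
    rw [← Nat.cast_sum, hA, Nat.cast_sub hM, Nat.cast_one]
  have hM' : (M : ℝ) ≠ 0 := by positivity
  simp only [averagedUnionBound, mul_zero, zero_div, Real.sqrt_zero, gaussianQ_zero,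
    ← Finset.sum_mul, hA', Finset.sum_const, Finset.card_univ, Fintype.card_fin, nsmul_eq_mul]
  field_simp

lemma averagedUnionBound_strictAntiOn (hM : 2 ≤ M) (hD : ∀ d ∈ D, 0 < d)
    (hA : ∀ i, ∑ d ∈ D, A i d = M - 1) (hE : 0 < E) (hσ : 0 < σ) :
    StrictAntiOn (averagedUnionBound D A E σ) (Set.Ici 0) := by
  intro x hx y _ hxy
  have hx : 0 ≤ x := hx
  have hQ : ∀ d ∈ D, gaussianQ (d * √(E * y / (2 * σ ^ 2))) <
      gaussianQ (d * √(E * x / (2 * σ ^ 2))) := fun d hd =>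
    gaussianQ_strictAnti (mul_lt_mul_of_pos_left
      (Real.sqrt_lt_sqrt (by positivity) (by gcongr)) (hD d hd))
  have : NeZero M := ⟨by omega⟩
  refine mul_lt_mul_of_pos_left (Finset.sum_lt_sum_of_nonempty Finset.univ_nonempty fun i _ => ?_)
    (by positivity)
  obtain ⟨d, hd, hAd⟩ : ∃ d ∈ D, A i d ≠ 0 :=
    Finset.exists_ne_zero_of_sum_ne_zero (by rw [hA]; omega)
  exact Finset.sum_lt_sum (fun d hd => mul_le_mul_of_nonneg_left (hQ d hd).le (by positivity))
    ⟨d, hd, mul_lt_mul_of_pos_left (hQ d hd) (by positivity)⟩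

lemma tendsto_averagedUnionBound_atTop (hD : ∀ d ∈ D, 0 < d) (hE : 0 < E) (hσ : 0 < σ) :
    Filter.Tendsto (averagedUnionBound D A E σ) Filter.atTop (nhds 0) := by
  have hQ : ∀ d ∈ D, Filter.Tendsto (fun x => gaussianQ (d * √(E * x / (2 * σ ^ 2))))
      Filter.atTop (nhds 0) := fun d hd =>
    tendsto_gaussianQ_atTop.comp ((Real.tendsto_sqrt_atTop.comp
      ((Filter.tendsto_id.const_mul_atTop hE).atTop_div_const (by positivity))).const_mul_atTop
        (hD d hd))
  have := (tendsto_finsetSum Finset.univ fun (i : Fin M) _ =>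
    tendsto_finsetSum D fun d hd => (hQ d hd).const_mul (A i d : ℝ)).const_mul (1 / (M : ℝ))
  simp only [mul_zero, Finset.sum_const_zero] at this
  exact this

lemma exists_averagedUnionBound_eq_one (hM : 3 ≤ M) (hD : ∀ d ∈ D, 0 < d)
    (hA : ∀ i, ∑ d ∈ D, A i d = M - 1) (hE : 0 < E) (hσ : 0 < σ) :
    ∃ x, 0 ≤ x ∧ averagedUnionBound D A E σ x = 1 := by
  obtain ⟨b, hb1, hb0⟩ :=
    (((tendsto_averagedUnionBound_atTop (A := A) hD hE hσ).eventually_le_const one_pos).and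
      (Filter.eventually_ge_atTop 0)).exists
  have h0 : 1 ≤ averagedUnionBound D A E σ 0 := by
    have : (3 : ℝ) ≤ M := by exact_mod_cast hM
    rw [averagedUnionBound_zero (by omega) hA]
    linarith
  obtain ⟨x, hx, hx1⟩ := intermediate_value_Icc' hb0
    continuous_averagedUnionBound.continuousOn ⟨hb1, h0⟩
  exact ⟨x, hx.1, hx1⟩

lemma integrable_gaussianQ_mul {f : ℝ → ℝ} (hf : Integrable f) {d : ℝ} (hd : 0 ≤ d) :
    Integrable fun x => gaussianQ (d * √(E * x / (2 * σ ^ 2))) * f x := by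
  refine hf.bdd_mul (c := 1 / 2) ?_ (.of_forall fun x => ?_)
  · have := continuous_gaussianQ
    exact Continuous.aestronglyMeasurable (by fun_prop)
  · rw [Real.norm_of_nonneg (gaussianQ_nonneg _), ← gaussianQ_zero]
    exact gaussianQ_strictAnti.antitone (by positivity)

lemma averagedUnionBound_mul (f : ℝ → ℝ) (x : ℝ) :
    averagedUnionBound D A E σ x * f x = (1 / (M : ℝ)) * ∑ i : Fin M, ∑ d ∈ D,
      (A i d : ℝ) * (gaussianQ (d * √(E * x / (2 * σ ^ 2))) * f x) := by
  simp only [averagedUnionBound, mul_assoc, Finset.sum_mul]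

lemma integrable_averagedUnionBound_mul {f : ℝ → ℝ} (hf : Integrable f) (hD : ∀ d ∈ D, 0 < d) :
    Integrable fun x => averagedUnionBound D A E σ x * f x := by
  simp only [averagedUnionBound_mul]
  exact (integrable_finsetSum _ fun i _ => integrable_finsetSum _ fun d hd =>
    (integrable_gaussianQ_mul hf (hD d hd).le).const_mul _).const_mul _

lemma setIntegral_averagedUnionBound_mul {f : ℝ → ℝ} (hf : Integrable f) (hD : ∀ d ∈ D, 0 < d)
    (s : Set ℝ) :
    ∫ x in s, averagedUnionBound D A E σ x * f x = (1 / (M : ℝ)) * ∑ i : Fin M, ∑ d ∈ D,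
      (A i d : ℝ) * ∫ x in s, gaussianQ (d * √(E * x / (2 * σ ^ 2))) * f x := by
  have hint (i : Fin M) : ∀ d ∈ D, Integrable (fun x =>
      (A i d : ℝ) * (gaussianQ (d * √(E * x / (2 * σ ^ 2))) * f x)) (volume.restrict s) :=
    fun d hd => ((integrable_gaussianQ_mul hf (hD d hd).le).const_mul _).integrableOn
  simp only [averagedUnionBound_mul]
  rw [integral_const_mul, integral_finsetSum _ fun i _ => integrable_finsetSum _ (hint i)]
  congr! 2 with i
  rw [integral_finsetSum _ (hint i)]
  simp only [integral_const_mul]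

end averagedUnionBound

lemma setIntegral_Iio_add_setIntegral_Ioi_sub {f g : ℝ → ℝ} (hf : Integrable f)
    (hg : Integrable g) (a b : ℝ) :
    ((∫ x in Set.Iio b, f x) + ∫ x in Set.Ioi b, g x) -
      ((∫ x in Set.Iio a, f x) + ∫ x in Set.Ioi a, g x) = ∫ x in a..b, (f x - g x) := by
  rw [intervalIntegral.integral_sub hf.intervalIntegrable hg.intervalIntegrable,
    ← intervalIntegral.integral_Iio_sub_Iio' hf.integrableOn hf.integrableOn,
    ← intervalIntegral.integral_Ioi_sub_Ioi' hg.integrableOn hg.integrableOn]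
  ring

theorem unique_minimiser_of_G
    (M : ℕ) (hM : 3 ≤ M)
    (D : Finset ℝ) (hD : ∀ d ∈ D, 0 < d)
    (A : Fin M → ℝ → ℕ) (hA : ∀ i, ∑ d ∈ D, A i d = M - 1)
    (E σ : ℝ) (hE : 0 < E) (hσ : 0 < σ)
    (f : ℝ → ℝ) (hf_cont : Continuous f)
    (hf_neg : ∀ x < (0 : ℝ), f x = 0)
    (hf_pos : ∀ x > (0 : ℝ), 0 < f x)
    (hf_int : ∫ x, f x = 1)
    (G : ℝ → ℝ)
    (hG : ∀ γ, G γ = (∫ x in Set.Iio γ, f x) +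
      (1 / (M : ℝ)) * ∑ i : Fin M, ∑ d ∈ D, (A i d : ℝ) *
        ∫ x in Set.Ioi γ, gaussianQ (d * Real.sqrt (E * x / (2 * σ ^ 2))) * f x) :
    ∃! γstar : ℝ, 0 ≤ γstar ∧
      ∀ γ : ℝ, 0 ≤ γ → γ ≠ γstar → G γstar < G γ := by
  have hf : Integrable f := Integrable.of_integral_ne_zero (by rw [hf_int]; exact one_ne_zero)
  set h := averagedUnionBound D A E σ
  have hh : Integrable fun x => h x * f x := integrable_averagedUnionBound_mul hf hD
  have hanti : StrictAntiOn h (Set.Ici 0) :=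
    averagedUnionBound_strictAntiOn (by omega) hD hA hE hσ
  have hsub (a b : ℝ) : G b - G a = ∫ x in a..b, (f x - h x * f x) := by
    rw [← setIntegral_Iio_add_setIntegral_Ioi_sub hf hh, hG, hG,
      setIntegral_averagedUnionBound_mul hf hD, setIntegral_averagedUnionBound_mul hf hD]
  obtain ⟨c, hc, hc1⟩ : ∃ c, 0 ≤ c ∧ h c = 1 := exists_averagedUnionBound_eq_one hM hD hA hE hσ
  have hmin : ∀ γ : ℝ, 0 ≤ γ → γ ≠ c → G c < G γ := by
    intro γ hγ hne
    rcases hne.lt_or_gt with hlt | hlt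
    · have : 0 < ∫ x in γ..c, (h x * f x - f x) := by
        refine intervalIntegral.intervalIntegral_pos_of_pos_on
          (hh.sub hf).intervalIntegrable (fun x hx => ?_) hlt
        have hx0 : 0 < x := hγ.trans_lt hx.1
        have := hanti hx0.le hc hx.2
        nlinarith [hf_pos x hx0]
      have hsymm : G γ - G c = ∫ x in γ..c, (h x * f x - f x) := by
        rw [← neg_sub, hsub, ← intervalIntegral.integral_neg]
        simp only [neg_sub]
      linarith
    · have : 0 < ∫ x in c..γ, (f x - h x * f x) := by
        refine intervalIntegral.intervalIntegral_pos_of_pos_on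
          (hf.sub hh).intervalIntegrable (fun x hx => ?_) hlt
        have hx0 : 0 < x := hc.trans_lt hx.1
        have := hanti hc hx0.le hx.1
        nlinarith [hf_pos x hx0]
      linarith [hsub c γ]
  refine ⟨c, ⟨hc, hmin⟩, fun y ⟨hy, hymin⟩ => ?_⟩
  by_contra hne
  exact lt_asymm (hmin y hy hne) (hymin c hc (Ne.symm hne))
end

section
/- (Craig's formula) For every real x ≥ 0, the Gaussian Q-function satisfies Q(x) = (1/π) ∫_{0}^{π/2} exp(−x²/(2 sin²θ)) dθ. -/
open MeasureTheory Real

theorem integrableOn_Ioi_mul_exp_neg_sq_div_two (a : ℝ) :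
    IntegrableOn (fun r : ℝ => r * exp (-r ^ 2 / 2)) (Set.Ioi a) := by
  have h := integrable_mul_exp_neg_mul_sq (b := 1 / 2) (by norm_num)
  refine (h.congr (ae_of_all _ fun r => ?_)).integrableOn
  simp only
  ring_nf

theorem integral_Ioi_mul_exp_neg_sq_div_two (a : ℝ) :
    ∫ r in Set.Ioi a, r * exp (-r ^ 2 / 2) = exp (-a ^ 2 / 2) := by
  have hd : ∀ r ∈ Set.Ici a,
      HasDerivAt (fun r : ℝ => -exp (-r ^ 2 / 2)) (r * exp (-r ^ 2 / 2)) r := by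
    intro r _
    have h := (((hasDerivAt_pow 2 r).neg.div_const 2).exp).neg
    convert! h using 1
    push_cast
    simp only [Pi.neg_apply]
    ring
  have ht : Filter.Tendsto (fun r : ℝ => -exp (-r ^ 2 / 2)) Filter.atTop (nhds 0) := by
    rw [← neg_zero]
    refine (tendsto_exp_atBot.comp ?_).neg
    have h : Filter.Tendsto (fun r : ℝ => r ^ 2 / 2) Filter.atTop Filter.atTop :=
      (Filter.tendsto_pow_atTop two_ne_zero).atTop_div_const two_pos
    simp_rw [neg_div]
    exact Filter.tendsto_neg_atTop_atBot.comp h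
  rw [integral_Ioi_of_hasDerivAt_of_tendsto' hd (integrableOn_Ioi_mul_exp_neg_sq_div_two a) ht]
  ring

theorem integral_Ioi_prod_Ioi_exp_neg_sq_div_two (x : ℝ) :
    ∫ p in Set.Ioi (0 : ℝ) ×ˢ Set.Ioi x, exp (-(p.1 ^ 2 + p.2 ^ 2) / 2) =
      √(2 * π) / 2 * ∫ t in Set.Ioi x, exp (-t ^ 2 / 2) := by
  have h : ∫ t in Set.Ioi (0 : ℝ), exp (-t ^ 2 / 2) = √(2 * π) / 2 := by
    have h := integral_gaussian_Ioi (1 / 2)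
    rw [show π / (1 / 2) = 2 * π by ring] at h
    rw [← h]
    congr 1 with t
    ring_nf
  rw [← h, ← setIntegral_prod_mul, ← Measure.volume_eq_prod]
  congr 1 with p
  rw [← exp_add]
  ring_nf

theorem setIntegral_polarCoord_target_of_quadrant {x : ℝ} (hx : 0 ≤ x) :
    ∫ p in polarCoord.target, p.1 • (Set.Ioi (0 : ℝ) ×ˢ Set.Ioi x).indicator
        (fun p : ℝ × ℝ => exp (-(p.1 ^ 2 + p.2 ^ 2) / 2)) (polarCoord.symm p) =
      ∫ θ in Set.Ioo 0 (π / 2), exp (-x ^ 2 / (2 * sin θ ^ 2)) := by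
  set S : Set (ℝ × ℝ) := {p | 0 < p.1 * cos p.2 ∧ x < p.1 * sin p.2} with hS
  have hSm : MeasurableSet S :=
    (measurableSet_lt (f := fun _ : ℝ × ℝ => (0 : ℝ)) (g := fun p => p.1 * cos p.2)
      (by fun_prop) (by fun_prop)).inter (measurableSet_lt (f := fun _ : ℝ × ℝ => x)
      (g := fun p => p.1 * sin p.2) (by fun_prop) (by fun_prop))
  have hF : ∀ p : ℝ × ℝ, p.1 • (Set.Ioi (0 : ℝ) ×ˢ Set.Ioi x).indicator
        (fun p : ℝ × ℝ => exp (-(p.1 ^ 2 + p.2 ^ 2) / 2)) (polarCoord.symm p) =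
      S.indicator (fun p => p.1 * exp (-p.1 ^ 2 / 2)) p := by
    rintro ⟨r, θ⟩
    simp only [Set.indicator_apply, polarCoord_symm_apply, Set.mem_prod, Set.mem_Ioi, hS,
      Set.mem_ofPred_eq, smul_eq_mul, mul_ite, mul_zero]
    congr 4
    linear_combination (-r ^ 2) * sin_sq_add_cos_sq θ
  have hint : IntegrableOn (S.indicator fun p => p.1 * exp (-p.1 ^ 2 / 2))
      (Set.Ioi (0 : ℝ) ×ˢ Set.Ioo (-π) π) (volume.prod volume) := by
    refine Integrable.indicator ?_ hSm
    rw [← Measure.prod_restrict]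
    simpa using Integrable.mul_prod (integrableOn_Ioi_mul_exp_neg_sq_div_two 0)
      (integrable_const (μ := volume.restrict (Set.Ioo (-π) π)) (1 : ℝ))
  have hr : ∀ θ ∈ Set.Ioo (-π) π,
      ∫ r in Set.Ioi (0 : ℝ), S.indicator (fun p => p.1 * exp (-p.1 ^ 2 / 2)) (r, θ) =
        (Set.Ioo 0 (π / 2)).indicator (fun θ => exp (-x ^ 2 / (2 * sin θ ^ 2))) θ := by
    intro θ hθ
    by_cases h : θ ∈ Set.Ioo 0 (π / 2)
    · have hs : 0 < sin θ := sin_pos_of_pos_of_lt_pi h.1 hθ.2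
      have hc : 0 < cos θ := cos_pos_of_mem_Ioo ⟨by linarith [h.1, pi_pos], h.2⟩
      have hxs : 0 ≤ x / sin θ := by positivity
      rw [Set.indicator_of_mem h]
      calc _ = ∫ r in Set.Ioi (0 : ℝ), (Set.Ioi (x / sin θ)).indicator
              (fun r => r * exp (-r ^ 2 / 2)) r := by
            refine setIntegral_congr_fun measurableSet_Ioi fun r hr => ?_
            have hr : 0 < r := hr
            simp [Set.indicator_apply, hS, div_lt_iff₀ hs, mul_pos hr hc]
        _ = ∫ r in Set.Ioi (x / sin θ), r * exp (-r ^ 2 / 2) := by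
            rw [setIntegral_indicator measurableSet_Ioi,
              Set.inter_eq_right.mpr (Set.Ioi_subset_Ioi hxs)]
        _ = _ := by
            rw [integral_Ioi_mul_exp_neg_sq_div_two]
            congr 1
            field_simp
    · rw [Set.indicator_of_notMem h]
      refine setIntegral_eq_zero_of_forall_eq_zero fun r hr => ?_
      have hr : 0 < r := hr
      refine Set.indicator_of_notMem (fun hm => h ?_) _
      obtain ⟨h1, h2⟩ : 0 < r * cos θ ∧ x < r * sin θ := hm
      have hc : 0 < cos θ := pos_of_mul_pos_right h1 hr.le
      have hs : 0 < sin θ := pos_of_mul_pos_right (hx.trans_lt h2) hr.le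
      constructor
      · by_contra! h0
        linarith [sin_nonpos_of_nonpos_of_neg_pi_le h0 hθ.1.le]
      · by_contra! h0
        linarith [cos_nonpos_of_pi_div_two_le_of_le h0 (by linarith [hθ.2, pi_pos])]
  simp_rw [hF]
  rw [polarCoord_target, Measure.volume_eq_prod, ← Measure.prod_restrict, integral_prod_symm _
    (by rw [Measure.prod_restrict]; exact hint),
    setIntegral_congr_fun measurableSet_Ioo hr, setIntegral_indicator measurableSet_Ioo,
    Set.inter_eq_right.mpr (Set.Ioo_subset_Ioo (by linarith [pi_pos]) (by linarith [pi_pos]))]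

/-- Craig's formula for the Gaussian Q-function. -/
theorem craig_formula (x : ℝ) (hx : 0 ≤ x) :
    gaussianQ x =
      (1 / Real.pi) * ∫ θ in (0 : ℝ)..(Real.pi / 2),
        Real.exp (-x ^ 2 / (2 * Real.sin θ ^ 2)) := by
  have h := integral_comp_polarCoord_symm ((Set.Ioi (0 : ℝ) ×ˢ Set.Ioi x).indicator
    fun p : ℝ × ℝ => exp (-(p.1 ^ 2 + p.2 ^ 2) / 2))
  rw [setIntegral_polarCoord_target_of_quadrant hx,
    integral_indicator (measurableSet_Ioi.prod measurableSet_Ioi),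
    integral_Ioi_prod_Ioi_exp_neg_sq_div_two] at h
  rw [gaussianQ, intervalIntegral.integral_of_le (by positivity), integral_Ioc_eq_integral_Ioo, h]
  have hsq : √(2 * π) ^ 2 = 2 * π := sq_sqrt (by positivity)
  have hpos : 0 < √(2 * π) := by positivity
  field_simp
  rw [hsq]
end
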